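/- Let X and A be finite nonempty types and d ≥ 1. Let Γ : Matrix ((Option (A × X)) × Fin d) ((Option (A × X)) × Fin d) ℂ be positive semidefinite, and write Γ[v,w] for the d × d block with entries Γ[v,w] i j = Γ (v,i) (w,j). Assume: (i) trace(Γ[none, none]) = 1; (ii) Γ[none, some (a,x)] = Γ[some (a,x), some (a,x)] = Γ[some (a,x), none] for all a, x; (iii) Γ[some (a,x), some (a',x)] = 0 whenever a ≠ a'; (iv) ∑_a Γ[none, some (a,x)] = Γ[none, none] for all x. Then the assemblage σ x a := Γ[none, some (a,x)] admits a quantum realisation: there exist n ≥ 1, a positive semidefinite ρ : Matrix (Fin n × Fin d) (Fin n × Fin d) ℂ with trace 1, and matrices M : X → A → Matrix (Fin n) (Fin n) ℂ with each M x a positive semidefinite and ∑_a M x a = 1 for every x, such that σ x a = ptr₁((M x a ⊗ₖ 1) * ρ) for all x, a. -/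

import Mathlib

open scoped Kronecker ComplexOrder

/-- Partial trace over the first tensor factor. -/
noncomputable def ptr1 {n d : ℕ} (M : Matrix (Fin n × Fin d) (Fin n × Fin d) ℂ) :
    Matrix (Fin d) (Fin d) ℂ :=
  Matrix.of fun i j => ∑ k : Fin n, M (k, i) (k, j)

open Matrix in
/-- A zero on the diagonal of a positive semidefinite matrix kills the whole column. -/
theorem Matrix.PosSemidef.apply_eq_zero_of_diag_eq_zero {n : Type*} [Fintype n]
    {B : Matrix n n ℂ} (hB : B.PosSemidef) {k : n} (hk : B k k = 0) (i : n) : B i k = 0 := by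
  classical
  have h : B *ᵥ Pi.single k 1 = 0 := by
    rw [← hB.dotProduct_mulVec_zero_iff]
    simpa [← Pi.single_star] using hk
  simpa using congrFun h i

open Matrix in
/-- Positive semidefinite matrices summing to a diagonal matrix `D` are of the form
`√D * N a * √D` for a measurement `N`. -/
theorem exists_measurement_of_sum_eq_diagonal {A n : Type*} [Fintype A] [Nonempty A] [Fintype n]
    [DecidableEq n] (D : n → ℝ) (τ : A → Matrix n n ℂ) (hτ : ∀ a, (τ a).PosSemidef)
    (hsum : ∑ a, τ a = diagonal fun i => (D i : ℂ)) :
    ∃ N : A → Matrix n n ℂ, (∀ a, (N a).PosSemidef) ∧ ∑ a, N a = 1 ∧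
      ∀ a, diagonal (fun i => ((√(D i) : ℝ) : ℂ)) * N a *
        diagonal (fun i => ((√(D i) : ℝ) : ℂ)) = τ a := by
  classical
  have hdiag (k : n) : ∑ a, τ a k k = (D k : ℂ) := by
    simpa [Matrix.sum_apply] using congrFun (congrFun hsum k) k
  have hD (k : n) : 0 ≤ D k := by
    have h : (0 : ℂ) ≤ (D k : ℂ) := hdiag k ▸ Finset.sum_nonneg fun a _ => (hτ a).diag_nonneg
    exact_mod_cast h
  have hcol (a : A) (i k : n) (hk : D k = 0) : τ a i k = 0 := by
    refine (hτ a).apply_eq_zero_of_diag_eq_zero ?_ i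
    have h := hdiag k
    rw [hk, Complex.ofReal_zero,
      Finset.sum_eq_zero_iff_of_nonneg fun a _ => (hτ a).diag_nonneg] at h
    exact h a (Finset.mem_univ a)
  have hrow (a : A) (i k : n) (hk : D k = 0) : τ a k i = 0 := by
    rw [← (hτ a).isHermitian.apply k i, hcol a i k hk, star_zero]
  let g : Matrix n n ℂ := diagonal fun i => (((√(D i))⁻¹ : ℝ) : ℂ)
  let q : Matrix n n ℂ := diagonal fun i => if D i = 0 then 1 else 0
  have hg : gᴴ = g := by
    simp only [g, diagonal_conjTranspose]
    congr 1
    funext i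
    simp
  have hq : q.PosSemidef := PosSemidef.diagonal fun i => by
    by_cases h : D i = 0 <;> simp [h]
  obtain ⟨a₀⟩ := ‹Nonempty A›
  refine ⟨fun a => g * τ a * g + if a = a₀ then q else 0, fun a => ?_, ?_, fun a => ?_⟩
  · refine PosSemidef.add ?_ ?_
    · simpa [hg] using (hτ a).mul_mul_conjTranspose_same g
    · split_ifs
      exacts [hq, PosSemidef.zero]
  · rw [Finset.sum_add_distrib, ← Finset.sum_mul, ← Finset.mul_sum, hsum, Finset.sum_ite_eq']
    simp only [Finset.mem_univ, if_true, g, q, diagonal_mul_diagonal, diagonal_add, ← diagonal_one]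
    congr 1
    funext k
    by_cases hk : D k = 0
    · simp [hk]
    · have hs : √(D k) ≠ 0 := (Real.sqrt_ne_zero (hD k)).2 hk
      rw [if_neg hk, add_zero]
      norm_cast
      nth_rewrite 2 [← Real.mul_self_sqrt (hD k)]
      field_simp
  · ext i j
    have hq0 (b : Matrix n n ℂ) (hb : b = q ∨ b = 0) : (√(D i) : ℂ) * b i j = 0 := by
      rcases hb with rfl | rfl
      · by_cases hi : D i = 0 <;> simp [q, diagonal_apply, hi]
      · simp
    simp only [diagonal_mul, mul_diagonal, Matrix.add_apply, mul_add, add_mul, g]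
    rw [hq0 _ (by split_ifs <;> simp), zero_mul, add_zero]
    by_cases hi : D i = 0
    · simp [hi, hrow a j i hi]
    by_cases hj : D j = 0
    · simp [hj, hcol a i j hj]
    have hsi : ((√(D i) : ℝ) : ℂ) ≠ 0 := by exact_mod_cast (Real.sqrt_ne_zero (hD i)).2 hi
    have hsj : ((√(D j) : ℝ) : ℂ) ≠ 0 := by exact_mod_cast (Real.sqrt_ne_zero (hD j)).2 hj
    push_cast
    field_simp

open Matrix in
/-- Ensembles with a common positive semidefinite average `R` all factor through a single
square root of `R` (in the sense `s * sᴴ = R`). -/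
theorem exists_common_factor_of_sum_eq {X A n : Type*} [Fintype A] [Nonempty A] [Fintype n]
    [DecidableEq n] (R : Matrix n n ℂ) (hR : R.PosSemidef) (σ : X → A → Matrix n n ℂ)
    (hσ : ∀ x a, (σ x a).PosSemidef) (hsum : ∀ x, ∑ a, σ x a = R) :
    ∃ s : Matrix n n ℂ, s * sᴴ = R ∧ ∃ N : X → A → Matrix n n ℂ,
      (∀ x a, (N x a).PosSemidef) ∧ (∀ x, ∑ a, N x a = 1) ∧
      ∀ x a, s * N x a * sᴴ = σ x a := by
  let U : Matrix n n ℂ := hR.isHermitian.eigenvectorUnitary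
  let D : n → ℝ := hR.isHermitian.eigenvalues
  have hUU : U * Uᴴ = 1 := Unitary.coe_mul_star_self hR.isHermitian.eigenvectorUnitary
  have hUU' : Uᴴ * U = 1 := Unitary.coe_star_mul_self hR.isHermitian.eigenvectorUnitary
  have hspec : R = U * diagonal (fun i => (D i : ℂ)) * Uᴴ := by
    conv_lhs => rw [hR.isHermitian.spectral_theorem]
    rfl
  have hspec' : Uᴴ * R * U = diagonal fun i => (D i : ℂ) := by
    rw [hspec, show Uᴴ * (U * diagonal (fun i => (D i : ℂ)) * Uᴴ) * U =
      (Uᴴ * U) * diagonal (fun i => (D i : ℂ)) * (Uᴴ * U) by simp only [Matrix.mul_assoc],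
      hUU', Matrix.one_mul, Matrix.mul_one]
  let r : Matrix n n ℂ := diagonal fun i => ((√(D i) : ℝ) : ℂ)
  have hr : rᴴ = r := by
    simp only [r, diagonal_conjTranspose]
    congr 1
    funext i
    simp
  have hrr : r * r = diagonal fun i => (D i : ℂ) := by
    simp only [r, diagonal_mul_diagonal]
    congr 1
    funext i
    exact_mod_cast Real.mul_self_sqrt (hR.eigenvalues_nonneg i)
  choose N hN hN1 hNτ using fun x =>
    exists_measurement_of_sum_eq_diagonal D (fun a => Uᴴ * σ x a * U)
      (fun a => (hσ x a).conjTranspose_mul_mul_same U)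
      (by rw [← Finset.sum_mul, ← Finset.mul_sum, hsum, hspec'])
  refine ⟨U * r, ?_, N, hN, hN1, fun x a => ?_⟩
  · rw [conjTranspose_mul, hr, hspec, ← hrr]
    simp only [Matrix.mul_assoc]
  · rw [conjTranspose_mul, hr, show U * r * N x a * (r * Uᴴ) = U * (r * N x a * r) * Uᴴ by
      simp only [Matrix.mul_assoc], hNτ x a, show U * (Uᴴ * σ x a * U) * Uᴴ =
      (U * Uᴴ) * σ x a * (U * Uᴴ) by simp only [Matrix.mul_assoc], hUU, Matrix.one_mul,
      Matrix.mul_one]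

open Matrix in
/-- Steering the purification `∑ k, |k⟩ ⊗ s|k⟩` with `Nᵀ` on the first factor. -/
theorem ptr1_kronecker_one_mul_vecMulVec {n d : ℕ} (s : Matrix (Fin d) (Fin n) ℂ)
    (N : Matrix (Fin n) (Fin n) ℂ) :
    ptr1 ((Nᵀ ⊗ₖ (1 : Matrix (Fin d) (Fin d) ℂ)) *
      vecMulVec (fun p : Fin n × Fin d => s p.2 p.1) (star fun p : Fin n × Fin d => s p.2 p.1)) =
      s * N * sᴴ := by
  ext i j
  simp only [ptr1, of_apply, Matrix.mul_apply, kroneckerMap_apply, vecMulVec_apply,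
    Fintype.sum_prod_type, transpose_apply, one_apply, Pi.star_apply, conjTranspose_apply,
    mul_ite, mul_one, mul_zero, ite_mul, zero_mul, Finset.sum_ite_eq, Finset.mem_univ, if_true,
    Finset.sum_mul]
  exact Finset.sum_congr rfl fun k _ => Finset.sum_congr rfl fun l _ => by ring

/-- Second half of the moment-matrix proof of the GHJW theorem: every bipartite
almost-quantum moment matrix yields a quantum realisation of the assemblage it
encodes. -/
theorem almost_quantum_moment_matrix_gives_quantum_realisation
    {X A : Type} [Fintype X] [Nonempty X] [Fintype A] [Nonempty A]
    {d : ℕ} (hd : 1 ≤ d)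
    (Γ : Matrix ((Option (A × X)) × Fin d) ((Option (A × X)) × Fin d) ℂ)
    (hΓ : Γ.PosSemidef)
    (htr : ∑ i : Fin d, Γ (none, i) (none, i) = 1)
    (heq : ∀ (a : A) (x : X) (i j : Fin d),
      Γ (none, i) (some (a, x), j) = Γ (some (a, x), i) (some (a, x), j) ∧
      Γ (some (a, x), i) (some (a, x), j) = Γ (some (a, x), i) (none, j))
    (hnull : ∀ (a a' : A) (x : X) (i j : Fin d), a ≠ a' →
      Γ (some (a, x), i) (some (a', x), j) = 0)
    (hsum : ∀ (x : X) (i j : Fin d),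
      ∑ a : A, Γ (none, i) (some (a, x), j) = Γ (none, i) (none, j))
    (σ : X → A → Matrix (Fin d) (Fin d) ℂ)
    (hσ : ∀ x a, σ x a = Matrix.of fun i j => Γ (none, i) (some (a, x), j)) :
    ∃ (n : ℕ), 1 ≤ n ∧
      ∃ (ρ : Matrix (Fin n × Fin d) (Fin n × Fin d) ℂ),
        ρ.PosSemidef ∧ ρ.trace = 1 ∧
        ∃ (M : X → A → Matrix (Fin n) (Fin n) ℂ),
          (∀ x a, (M x a).PosSemidef) ∧
          (∀ x, ∑ a : A, M x a = 1) ∧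
          (∀ x a, σ x a = ptr1 ((M x a ⊗ₖ (1 : Matrix (Fin d) (Fin d) ℂ)) * ρ)) := by
  let R : Matrix (Fin d) (Fin d) ℂ := Matrix.of fun i j => Γ (none, i) (none, j)
  have hR : R.PosSemidef := hΓ.submatrix fun i => (none, i)
  have hσpsd (x : X) (a : A) : (σ x a).PosSemidef := by
    have h : σ x a = Γ.submatrix (fun i => (some (a, x), i)) fun i => (some (a, x), i) := by
      ext i j
      simpa [hσ] using (heq a x i j).1
    exact h ▸ hΓ.submatrix _
  have hσsum (x : X) : ∑ a, σ x a = R := by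
    ext i j
    simpa [hσ, Matrix.sum_apply, R] using hsum x i j
  obtain ⟨s, hs, N, hN, hN1, hNσ⟩ := exists_common_factor_of_sum_eq R hR σ hσpsd hσsum
  refine ⟨d, hd, _, Matrix.posSemidef_vecMulVec_self_star
    (fun p : Fin d × Fin d => s p.2 p.1), ?_, fun x a => (N x a).transpose,
    fun x a => (hN x a).transpose, fun x => ?_, fun x a => ?_⟩
  · have h : (s * s.conjTranspose).trace = 1 := by
      rw [hs]
      exact htr
    rw [← h]
    simp only [Matrix.trace, Matrix.diag_apply, Matrix.vecMulVec_apply, Matrix.mul_apply,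
      Fintype.sum_prod_type, Pi.star_apply, Matrix.conjTranspose_apply]
    exact Finset.sum_comm
  · rw [← Matrix.transpose_sum, hN1, Matrix.transpose_one]
  · rw [ptr1_kronecker_one_mul_vecMulVec, hNσ]
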